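/- Let R = K[x_1,…,x_n] be the polynomial ring over a field K and M a finitely generated graded R-module of projective dimension p. Then for every j = 0,…,p one has reg_j(M) ≤ Σ_{k=0}^{j} ρ_k(M) − j, where reg_j(M) = max{ k − j : β_{jk}^R(M) ≠ 0 } is the regularity of the j-th step of the minimal graded free resolution, ρ_0(M) = reg_0(M) is the maximal degree of a minimal homogeneous generator of M, and for k ≥ 1, ρ_k(M) is the Artin-Rees number of the k-th syzygy module inside the (k−1)-st free module of the minimal graded free resolution of M. In particular, the Castelnuovo-Mumford regularity satisfies reg(M) ≤ max{ Σ_{k=0}^{j} ρ_k(M) − j : j = 0,…,p }. -/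

import Mathlib

open Submodule MvPolynomial

section

variable {K : Type*} [Field K] (n : ℕ)

/-- Homogeneous polynomials of (integer) degree `z`: the usual homogeneous polynomials of
degree `z` for `z ≥ 0`, and `0` for `z < 0`. -/
noncomputable def homZ (z : ℤ) : Submodule K (MvPolynomial (Fin n) K) :=
  if 0 ≤ z then homogeneousSubmodule (Fin n) K z.toNat else ⊥

/-- The homogeneous elements of degree `t` of the graded free module
`F = ⊕_r R(-deg r)` over `R = K[x_1, …, x_n]`. -/
noncomputable def freeHomPiece {s : ℕ} (deg : Fin s → ℤ) (t : ℤ) :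
    Submodule K (Fin s → MvPolynomial (Fin n) K) :=
  Submodule.pi Set.univ fun r => homZ n (t - deg r)

/-- The graded (irrelevant) maximal ideal `m = (x_1, …, x_n)` of `K[x_1, …, x_n]`. -/
noncomputable def polyMaxIdeal (K : Type*) [Field K] (n : ℕ) : Ideal (MvPolynomial (Fin n) K) :=
  Ideal.span (Set.range MvPolynomial.X)

/-- The Artin–Rees number `ρ(N, P)` with respect to an ideal `m`: the smallest `r` such
that `N ∩ m^i P = m^{i-r} (N ∩ m^r P)` for all `i ≥ r`. -/
noncomputable def artinReesNumber {R : Type*} [CommRing R] {M : Type*} [AddCommGroup M]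
    [Module R M] (m : Ideal R) (N P : Submodule R M) : ℕ :=
  sInf {r : ℕ | ∀ i : ℕ, r ≤ i → N ⊓ m ^ i • P = m ^ (i - r) • (N ⊓ m ^ r • P)}

variable (M : Type*) [AddCommGroup M] [Module (MvPolynomial (Fin n) K) M] [Module K M]
  (ℳ : ℤ → Submodule K M)

/-- A minimal graded free resolution `… → F_1 → F_0 → M → 0` of a graded module `M` over
the polynomial ring `R = K[x_1, …, x_n]`, with `F_j = ⊕_{r < β j} R(-deg j r)`: the
augmentation and the differentials are graded (degree-preserving), the complex is exact,
and all differentials have image contained in `m F_j`, where `m = (x_1, …, x_n)`. -/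
structure GradedMinFreeRes where
  β : ℕ → ℕ
  deg : ∀ j : ℕ, Fin (β j) → ℤ
  aug : (Fin (β 0) → MvPolynomial (Fin n) K) →ₗ[MvPolynomial (Fin n) K] M
  d : ∀ j : ℕ, (Fin (β (j + 1)) → MvPolynomial (Fin n) K)
        →ₗ[MvPolynomial (Fin n) K] (Fin (β j) → MvPolynomial (Fin n) K)
  aug_surj : Function.Surjective aug
  exact_aug : LinearMap.ker aug = LinearMap.range (d 0)
  exact : ∀ j : ℕ, LinearMap.ker (d j) = LinearMap.range (d (j + 1))
  minimal : ∀ j : ℕ, LinearMap.range (d j) ≤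
    polyMaxIdeal K n • (⊤ : Submodule (MvPolynomial (Fin n) K) (Fin (β j) → MvPolynomial (Fin n) K))
  aug_graded : ∀ (t : ℤ) (x : Fin (β 0) → MvPolynomial (Fin n) K),
    x ∈ freeHomPiece n (deg 0) t → aug x ∈ ℳ t
  d_graded : ∀ (j : ℕ) (t : ℤ) (x : Fin (β (j + 1)) → MvPolynomial (Fin n) K),
    x ∈ freeHomPiece n (deg (j + 1)) t → d j x ∈ freeHomPiece n (deg j) t

variable {n M ℳ}

/-- `ρ_k(M)` for `k ≥ 1`: the Artin–Rees number of the `k`-th syzygy module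
`N_k = Range (d (k-1)) ⊆ F_{k-1}` of the minimal graded free resolution. -/
noncomputable def GradedMinFreeRes.rho (F : GradedMinFreeRes n M ℳ) (k : ℕ) : ℕ :=
  artinReesNumber (polyMaxIdeal _ n) (LinearMap.range (F.d (k - 1))) ⊤

/-- `ρ_0(M) = reg_0(M)`: the maximal degree of a minimal homogeneous generator of `M`,
i.e. the largest twist in homological degree `0`. -/
noncomputable def GradedMinFreeRes.rho0 (F : GradedMinFreeRes n M ℳ) : WithBot ℤ :=
  Finset.univ.sup fun r : Fin (F.β 0) => ((F.deg 0 r : ℤ) : WithBot ℤ)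

/-- `Σ_{k=0}^{j} ρ_k(M) - j`. -/
noncomputable def GradedMinFreeRes.rhoSum (F : GradedMinFreeRes n M ℳ) (j : ℕ) : WithBot ℤ :=
  F.rho0 + (((∑ k ∈ Finset.Icc 1 j, (F.rho k : ℤ)) - (j : ℤ) : ℤ) : WithBot ℤ)

end

theorem MvPolynomial.IsHomogeneous.mem_polyMaxIdeal_pow {K : Type*} [Field K] {n k m : ℕ}
    {p : MvPolynomial (Fin n) K} (hp : p.IsHomogeneous m) (hkm : k ≤ m) :
    p ∈ polyMaxIdeal K n ^ k := by
  refine (MvPolynomial.mem_pow_idealOfVars_iff' k p).mpr fun x hx => ?_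
  by_contra h
  have hdeg : x.degree = m := by
    rw [Finsupp.degree_eq_weight_one]
    exact hp h
  omega

theorem mem_polyMaxIdeal_pow_of_mem_homZ {K : Type*} [Field K] {n k : ℕ} {z : ℤ}
    {p : MvPolynomial (Fin n) K} (hp : p ∈ homZ n z) (hkz : (k : ℤ) ≤ z) :
    p ∈ polyMaxIdeal K n ^ k := by
  rw [homZ, if_pos (by omega), mem_homogeneousSubmodule] at hp
  exact hp.mem_polyMaxIdeal_pow (by omega)

theorem one_notMem_polyMaxIdeal {K : Type*} [Field K] {n : ℕ} :
    (1 : MvPolynomial (Fin n) K) ∉ polyMaxIdeal K n := by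
  have hle : polyMaxIdeal K n ≤ RingHom.ker (constantCoeff (σ := Fin n) (R := K)) := by
    rw [polyMaxIdeal, Ideal.span_le]
    rintro _ ⟨i, rfl⟩
    simp
  intro h
  simpa using hle h

theorem Ideal.mem_smul_top_pi_iff {R ι : Type*} [CommRing R] [Fintype ι] {I : Ideal R}
    {f : ι → R} : f ∈ I • (⊤ : Submodule R (ι → R)) ↔ ∀ i, f i ∈ I := by
  classical
  refine ⟨fun hf i => ?_, fun hf => ?_⟩
  · refine Submodule.smul_induction_on (p := fun g => g i ∈ I) hf
      (fun a ha g _ => I.mul_mem_right (g i) ha) fun g h hg hh => I.add_mem hg hh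
  · rw [pi_eq_sum_univ' f]
    exact Submodule.sum_mem _ fun i _ => Submodule.smul_mem_smul (hf i) Submodule.mem_top

/-- The Artin–Rees number is attained, by the Artin–Rees lemma. -/
theorem inf_pow_smul_top_eq_of_artinReesNumber_le {R : Type*} [CommRing R] [IsNoetherianRing R]
    {P : Type*} [AddCommGroup P] [Module R P] [Module.Finite R P] (I : Ideal R)
    (N : Submodule R P) {i : ℕ} (hi : artinReesNumber I N ⊤ ≤ i) :
    N ⊓ I ^ i • ⊤ =
      I ^ (i - artinReesNumber I N ⊤) • (N ⊓ I ^ artinReesNumber I N ⊤ • (⊤ : Submodule R P)) := by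
  have hne : {r : ℕ | ∀ i : ℕ, r ≤ i →
      N ⊓ I ^ i • (⊤ : Submodule R P) = I ^ (i - r) • (N ⊓ I ^ r • ⊤)}.Nonempty := by
    obtain ⟨k, hk⟩ := I.exists_pow_inf_eq_pow_smul N
    exact ⟨k, fun i hki => by simpa only [inf_comm] using hk i hki⟩
  exact Nat.sInf_mem hne i hi

theorem inf_pow_succ_artinReesNumber_smul_top_le {R : Type*} [CommRing R] [IsNoetherianRing R]
    {P : Type*} [AddCommGroup P] [Module R P] [Module.Finite R P] (I : Ideal R)
    (N : Submodule R P) : N ⊓ I ^ (artinReesNumber I N ⊤ + 1) • ⊤ ≤ I • N := by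
  rw [inf_pow_smul_top_eq_of_artinReesNumber_le I N (Nat.le_add_right _ 1), Nat.add_sub_cancel_left,
    pow_one]
  exact Submodule.smul_mono le_rfl inf_le_left

theorem single_one_mem_freeHomPiece {K : Type*} [Field K] {n s : ℕ} (deg : Fin s → ℤ)
    (r : Fin s) :
    Pi.single r 1 ∈ freeHomPiece (K := K) n deg (deg r) := by
  intro r' _
  obtain rfl | h := eq_or_ne r' r
  · simp only [SetLike.mem_coe, Pi.single_eq_same, sub_self, homZ, if_pos le_rfl]
    exact isHomogeneous_one (Fin n) K
  · simp [h]

namespace GradedMinFreeRes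

variable {K : Type*} [Field K] {n : ℕ} {M : Type*} [AddCommGroup M]
  [Module (MvPolynomial (Fin n) K) M] [Module K M] {ℳ : ℤ → Submodule K M}
  (F : GradedMinFreeRes n M ℳ)

/-- By minimality, the differential maps basis vectors to minimal generators of its range. -/
theorem d_single_one_notMem_smul_range (j : ℕ) (r : Fin (F.β (j + 1))) :
    F.d j (Pi.single r 1) ∉ polyMaxIdeal K n • LinearMap.range (F.d j) := by
  intro h
  rw [LinearMap.range_eq_map, ← Submodule.map_smul''] at h
  obtain ⟨x, hx, hdx⟩ := h
  have hker : Pi.single r 1 - x ∈ LinearMap.ker (F.d j) := by simp [hdx]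
  rw [F.exact j] at hker
  have hsingle := add_mem (F.minimal (j + 1) hker) hx
  rw [sub_add_cancel, Ideal.mem_smul_top_pi_iff] at hsingle
  exact one_notMem_polyMaxIdeal (by simpa using hsingle r)

theorem exists_deg_succ_le (j : ℕ) (r : Fin (F.β (j + 1))) :
    ∃ s : Fin (F.β j), F.deg (j + 1) r ≤ F.deg j s + F.rho (j + 1) := by
  by_contra! h
  refine F.d_single_one_notMem_smul_range j r
    (inf_pow_succ_artinReesNumber_smul_top_le _ _ ⟨LinearMap.mem_range_self _ _, ?_⟩)
  refine Ideal.mem_smul_top_pi_iff.mpr fun s => mem_polyMaxIdeal_pow_of_mem_homZ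
    (F.d_graded j _ _ (single_one_mem_freeHomPiece (F.deg (j + 1)) r) s (Set.mem_univ s)) ?_
  have hs : F.deg j s + (artinReesNumber (polyMaxIdeal K n) (LinearMap.range (F.d j)) ⊤ : ℤ) <
      F.deg (j + 1) r := h s
  push_cast
  omega

theorem exists_deg_le_deg_zero_add_sum_rho (j : ℕ) (r : Fin (F.β j)) :
    ∃ s : Fin (F.β 0), F.deg j r ≤ F.deg 0 s + ∑ k ∈ Finset.Icc 1 j, (F.rho k : ℤ) := by
  induction j with
  | zero => exact ⟨r, by simp⟩
  | succ j ih =>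
    obtain ⟨t, ht⟩ := F.exists_deg_succ_le j r
    obtain ⟨s, hs⟩ := ih t
    refine ⟨s, ?_⟩
    rw [Finset.sum_Icc_succ_top (Nat.le_add_left 1 j)]
    omega

theorem deg_sub_le_rhoSum (j : ℕ) (r : Fin (F.β j)) :
    ((F.deg j r - (j : ℤ) : ℤ) : WithBot ℤ) ≤ F.rhoSum j := by
  obtain ⟨s, hs⟩ := F.exists_deg_le_deg_zero_add_sum_rho j r
  have hrho0 : ((F.deg 0 s : ℤ) : WithBot ℤ) ≤ F.rho0 :=
    Finset.le_sup (f := fun r : Fin (F.β 0) => ((F.deg 0 r : ℤ) : WithBot ℤ)) (Finset.mem_univ s)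
  calc ((F.deg j r - (j : ℤ) : ℤ) : WithBot ℤ)
      ≤ ((F.deg 0 s + (∑ k ∈ Finset.Icc 1 j, (F.rho k : ℤ) - j) : ℤ) : WithBot ℤ) :=
        WithBot.coe_le_coe.mpr (by omega)
    _ ≤ F.rhoSum j := by
        rw [WithBot.coe_add]
        exact add_le_add_left hrho0 _

end GradedMinFreeRes

/-- Let `R = K[x_1, …, x_n]` and `M` a finitely generated graded
`R`-module of projective dimension `p`.  Then `reg_j(M) ≤ Σ_{k=0}^{j} ρ_k(M) - j` for
`j = 0, …, p`: every twist `b_{j,r} = deg j r` of the `j`-th step of the minimal graded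
free resolution satisfies `deg j r - j ≤ Σ_{k=0}^{j} ρ_k(M) - j`.  In particular
`reg(M) ≤ max_{0 ≤ j ≤ p} (Σ_{k=0}^{j} ρ_k(M) - j)`. -/
theorem statement10 {K : Type*} [Field K] {n : ℕ}
    {M : Type*} [AddCommGroup M] [Module (MvPolynomial (Fin n) K) M] [Module K M]
    [IsScalarTower K (MvPolynomial (Fin n) K) M] [Module.Finite (MvPolynomial (Fin n) K) M]
    {ℳ : ℤ → Submodule K M} [DirectSum.Decomposition ℳ]
    (hcompat : ∀ (p : ℕ) (a : MvPolynomial (Fin n) K), a ∈ homogeneousSubmodule (Fin n) K p →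
      ∀ (t : ℤ) (w : M), w ∈ ℳ t → a • w ∈ ℳ ((p : ℤ) + t))
    (p : ℕ) (F : GradedMinFreeRes n M ℳ)
    (hpd₁ : ∀ j : ℕ, p < j → F.β j = 0) (hpd₂ : F.β p ≠ 0) :
    (∀ j : ℕ, j ≤ p → ∀ r : Fin (F.β j),
      ((F.deg j r - (j : ℤ) : ℤ) : WithBot ℤ) ≤ F.rhoSum j) ∧
    (∀ j : ℕ, j ≤ p → ∀ r : Fin (F.β j),
      ((F.deg j r - (j : ℤ) : ℤ) : WithBot ℤ) ≤
        (Finset.Icc 0 p).sup fun j' => F.rhoSum j') := by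
  refine ⟨fun j _ r => F.deg_sub_le_rhoSum j r, fun j hj r => ?_⟩
  exact (F.deg_sub_le_rhoSum j r).trans
    (Finset.le_sup (f := fun j' => F.rhoSum j') (Finset.mem_Icc.mpr ⟨j.zero_le, hj⟩))
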